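/- arXiv:1709.05450 — 2 statements merged into one kernel-verified Lean document; each statement's English description precedes it below -/
import Mathlib

section
/- For all n×n positive definite matrices X and Y, all t ≤ 0 and all r > 0, Tr[X log(X^r #_t Y^r)] ≥ Tr[X ((1-t) log X^r + t log Y^r)]. -/
open Matrix ComplexOrder

noncomputable def mlog {n : Type*} [Fintype n] [DecidableEq n] (A : Matrix n n ℂ) : Matrix n n ℂ :=
  cfc Real.log A

noncomputable def mpow {n : Type*} [Fintype n] [DecidableEq n] (A : Matrix n n ℂ) (p : ℝ) :
    Matrix n n ℂ :=
  cfc (fun x : ℝ => x ^ p) A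

noncomputable def rtr {n : Type*} [Fintype n] [DecidableEq n] (A : Matrix n n ℂ) : ℝ :=
  A.trace.re

/-- The weighted geometric mean `A #_t B = A^{1/2} (A^{-1/2} B A^{-1/2})^t A^{1/2}`,
defined for all real `t`. -/
noncomputable def gm {n : Type*} [Fintype n] [DecidableEq n] (A B : Matrix n n ℂ) (t : ℝ) :
    Matrix n n ℂ :=
  mpow A (1 / 2) * mpow (mpow A (-(1 / 2)) * B * mpow A (-(1 / 2))) t * mpow A (1 / 2)

open Filter Topology

/-- The real vector `d`, as a complex diagonal matrix. -/
noncomputable def realDiagonal {n : Type*} [DecidableEq n] (d : n → ℝ) : Matrix n n ℂ :=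
  diagonal fun i => (d i : ℂ)

section TraceLog

variable {n : Type*} [DecidableEq n]

lemma realDiagonal_add (d e : n → ℝ) :
    realDiagonal d + realDiagonal e = realDiagonal fun i => d i + e i := by
  simp [realDiagonal, diagonal_add]

lemma realDiagonal_const (c : ℝ) : realDiagonal (fun _ : n => c) = c • 1 := by
  ext i j
  by_cases h : i = j <;> simp [realDiagonal, diagonal, one_apply, h]

lemma realDiagonal_conjTranspose (d : n → ℝ) : (realDiagonal d)ᴴ = realDiagonal d := by
  rw [realDiagonal, diagonal_conjTranspose]
  congr 1
  ext i
  simp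

lemma realDiagonal_posDef {d : n → ℝ} (hd : ∀ i, 0 < d i) : (realDiagonal d).PosDef :=
  PosDef.diagonal fun i => by simpa using hd i

variable [Fintype n]

lemma realDiagonal_mul (d e : n → ℝ) :
    realDiagonal d * realDiagonal e = realDiagonal fun i => d i * e i := by
  simp [realDiagonal, diagonal_mul_diagonal]

lemma posDef_realDiagonal_conj {d : n → ℝ} (hd : ∀ i, 0 < d i) {M : Matrix n n ℂ}
    (hM : M.PosDef) : (realDiagonal d * M * realDiagonal d).PosDef := by
  have h := (Matrix.IsUnit.posDef_star_right_conjugate_iff (x := M)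
    (realDiagonal_posDef hd).isUnit).2 hM
  rwa [star_eq_conjTranspose, realDiagonal_conjTranspose] at h

lemma isUnit_unitaryGroup (U : unitaryGroup n ℂ) : IsUnit (U : Matrix n n ℂ) :=
  IsUnit.of_mul_eq_one _ (Unitary.coe_mul_star_self U)

lemma aeval_conj_realDiagonal (U : unitaryGroup n ℂ) (d : n → ℝ) (p : Polynomial ℝ) :
    Polynomial.aeval ((U : Matrix n n ℂ) * realDiagonal d * star (U : Matrix n n ℂ)) p =
      (U : Matrix n n ℂ) * realDiagonal (fun i => p.eval (d i)) * star (U : Matrix n n ℂ) := by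
  have hU : star (U : Matrix n n ℂ) * U = 1 := Unitary.coe_star_mul_self U
  have hU' : (U : Matrix n n ℂ) * star (U : Matrix n n ℂ) = 1 := Unitary.coe_mul_star_self U
  induction p using Polynomial.induction_on' with
  | add p q hp hq =>
    rw [map_add, hp, hq, ← add_mul, ← mul_add, realDiagonal_add]
    simp
  | monomial k a =>
    rw [Polynomial.aeval_monomial]
    have hk : ((U : Matrix n n ℂ) * realDiagonal d * star (U : Matrix n n ℂ)) ^ k =
        (U : Matrix n n ℂ) * realDiagonal (fun i => d i ^ k) * star (U : Matrix n n ℂ) := by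
      induction k with
      | zero => simp [realDiagonal_const, hU']
      | succ k ih =>
        rw [pow_succ, ih]
        calc _ = (U : Matrix n n ℂ) * realDiagonal (fun i => d i ^ k) *
              (star (U : Matrix n n ℂ) * U) * realDiagonal d * star (U : Matrix n n ℂ) := by
              simp only [mul_assoc]
          _ = _ := by
              rw [hU, mul_one, mul_assoc (U : Matrix n n ℂ), realDiagonal_mul]
              simp only [pow_succ]
    have ha : realDiagonal (fun i => a * d i ^ k) = a • realDiagonal (fun i => d i ^ k) := by
      ext i j
      by_cases h : i = j <;> simp [realDiagonal, diagonal, h]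
    simp only [Polynomial.eval_monomial]
    rw [hk, ha, Algebra.algebraMap_eq_smul_one, smul_mul_assoc, one_mul, mul_smul_comm,
      smul_mul_assoc]

lemma spectrum_conj_realDiagonal (U : unitaryGroup n ℂ) (d : n → ℝ) :
    spectrum ℝ ((U : Matrix n n ℂ) * realDiagonal d * star (U : Matrix n n ℂ)) ⊆
      Set.range d := by
  rw [Unitary.spectrum_star_right_conjugate]
  intro x hx
  have h : (algebraMap ℝ ℂ x) ∈ spectrum ℂ (realDiagonal d) :=
    (spectrum.algebraMap_mem_iff ℂ).2 hx
  rw [realDiagonal, spectrum_diagonal] at h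
  obtain ⟨i, hi⟩ := h
  exact ⟨i, by simpa using hi⟩

lemma cfc_conj_realDiagonal (f : ℝ → ℝ) (U : unitaryGroup n ℂ) (d : n → ℝ) :
    cfc f ((U : Matrix n n ℂ) * realDiagonal d * star (U : Matrix n n ℂ)) =
      (U : Matrix n n ℂ) * realDiagonal (fun i => f (d i)) * star (U : Matrix n n ℂ) := by
  set p := Lagrange.interpolate (Finset.univ.image d) id f with hp
  have hpd : ∀ i, p.eval (d i) = f (d i) := fun i =>
    Lagrange.eval_interpolate_at_node f Function.injective_id.injOn
      (Finset.mem_image_of_mem d (Finset.mem_univ i))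
  have hsa : IsSelfAdjoint ((U : Matrix n n ℂ) * realDiagonal d * star (U : Matrix n n ℂ)) := by
    rw [isSelfAdjoint_iff, star_mul, star_mul, star_star, star_eq_conjTranspose (realDiagonal d),
      realDiagonal_conjTranspose, mul_assoc]
  have hfp : (spectrum ℝ ((U : Matrix n n ℂ) * realDiagonal d *
      star (U : Matrix n n ℂ))).EqOn f p.eval := by
    intro x hx
    obtain ⟨i, rfl⟩ := spectrum_conj_realDiagonal U d hx
    exact (hpd i).symm
  rw [cfc_congr hfp, cfc_polynomial p _ hsa, aeval_conj_realDiagonal]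
  simp only [hpd]

lemma Matrix.PosDef.exists_eq_conj_realDiagonal {M : Matrix n n ℂ} (hM : M.PosDef) :
    ∃ (U : unitaryGroup n ℂ) (d : n → ℝ), (∀ i, 0 < d i) ∧
      M = (U : Matrix n n ℂ) * realDiagonal d * star (U : Matrix n n ℂ) :=
  ⟨hM.1.eigenvectorUnitary, hM.1.eigenvalues, hM.eigenvalues_pos, by
    conv_lhs => rw [hM.1.spectral_theorem]
    rfl⟩

lemma conj_realDiagonal_apply_self_re (U : unitaryGroup n ℂ) (d : n → ℝ) (i : n) :
    (((U : Matrix n n ℂ) * realDiagonal d * star (U : Matrix n n ℂ)) i i).re =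
      ∑ k, Complex.normSq ((U : Matrix n n ℂ) i k) * d k := by
  rw [realDiagonal, mul_apply]
  simp only [mul_diagonal, star_apply, Complex.re_sum]
  refine Finset.sum_congr rfl fun k _ => ?_
  simp [Complex.normSq_apply]
  ring

lemma sum_normSq_unitary (U : unitaryGroup n ℂ) (i : n) :
    ∑ k, Complex.normSq ((U : Matrix n n ℂ) i k) = 1 := by
  have h := conj_realDiagonal_apply_self_re U (fun _ => 1) i
  have hU : (U : Matrix n n ℂ) * star (U : Matrix n n ℂ) = 1 := Unitary.coe_mul_star_self U
  rw [realDiagonal_const, one_smul, mul_one, hU] at h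
  simpa using h.symm

lemma conj_realDiagonal_add_smul_one (U : unitaryGroup n ℂ) (d : n → ℝ) (s : ℝ) :
    (U : Matrix n n ℂ) * realDiagonal d * star (U : Matrix n n ℂ) + s • 1 =
      (U : Matrix n n ℂ) * realDiagonal (fun i => d i + s) * star (U : Matrix n n ℂ) := by
  have hU : (U : Matrix n n ℂ) * star (U : Matrix n n ℂ) = 1 := Unitary.coe_mul_star_self U
  rw [← realDiagonal_add, realDiagonal_const, mul_add, add_mul, mul_smul_comm, mul_one,
    smul_mul_assoc, hU]

lemma conj_realDiagonal_inv (U : unitaryGroup n ℂ) {d : n → ℝ} (hd : ∀ i, 0 < d i) :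
    ((U : Matrix n n ℂ) * realDiagonal d * star (U : Matrix n n ℂ))⁻¹ =
      (U : Matrix n n ℂ) * realDiagonal (fun i => (d i)⁻¹) * star (U : Matrix n n ℂ) := by
  refine inv_eq_right_inv ?_
  have hU : star (U : Matrix n n ℂ) * U = 1 := Unitary.coe_star_mul_self U
  calc _ = (U : Matrix n n ℂ) * realDiagonal d * (star (U : Matrix n n ℂ) * U) *
        realDiagonal (fun i => (d i)⁻¹) * star (U : Matrix n n ℂ) := by simp only [mul_assoc]
    _ = 1 := by
      rw [hU, mul_one, mul_assoc (U : Matrix n n ℂ), realDiagonal_mul]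
      simp [(hd _).ne', realDiagonal_const]

lemma sum_mlog_apply_self_re {M : Matrix n n ℂ} (hM : M.PosDef) :
    ∑ i, (mlog M i i).re = Real.log M.det.re := by
  obtain ⟨U, d, hd, rfl⟩ := hM.exists_eq_conj_realDiagonal
  have htr : ∑ i, (mlog ((U : Matrix n n ℂ) * realDiagonal d * star (U : Matrix n n ℂ)) i i).re =
      (trace (mlog ((U : Matrix n n ℂ) * realDiagonal d * star (U : Matrix n n ℂ)))).re := by
    simp [trace]
  rw [htr, mlog, cfc_conj_realDiagonal, trace_mul_comm, ← mul_assoc, Unitary.coe_star_mul_self,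
    one_mul, det_mul_comm, ← mul_assoc, Unitary.coe_star_mul_self, one_mul, realDiagonal,
    realDiagonal, det_diagonal, ← Complex.ofReal_prod, Complex.ofReal_re,
    Real.log_prod (fun i _ => (hd i).ne')]
  simp


lemma sum_mul_log_le_of_sum_div_le {ι κ : Type*} [Fintype ι] [Fintype κ] {w μ : ι → ℝ}
    {w' μ' : κ → ℝ} (hw : ∑ i, w i = 1) (hw' : ∑ i, w' i = 1)
    (hμ : ∀ i, 0 < μ i) (hμ' : ∀ i, 0 < μ' i)
    (h : ∀ s > 0, ∑ i, w' i * (μ' i + s)⁻¹ ≤ ∑ i, w i * (μ i + s)⁻¹) :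
    ∑ i, w i * Real.log (μ i) ≤ ∑ i, w' i * Real.log (μ' i) := by
  set F : ℝ → ℝ := fun s =>
    ∑ i, w' i * Real.log (s + μ' i) - ∑ i, w i * Real.log (s + μ i) with hF
  have hderiv : ∀ s, 0 ≤ s → HasDerivAt F
      (∑ i, w' i * (μ' i + s)⁻¹ - ∑ i, w i * (μ i + s)⁻¹) s := by
    intro s hs
    refine HasDerivAt.sub (HasDerivAt.fun_sum fun i _ => HasDerivAt.const_mul _ ?_)
      (HasDerivAt.fun_sum fun i _ => HasDerivAt.const_mul _ ?_)
    · have := ((hasDerivAt_id s).add_const (μ' i)).log (by have := hμ' i; simp; positivity)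
      simpa [add_comm] using this
    · have := ((hasDerivAt_id s).add_const (μ i)).log (by have := hμ i; simp; positivity)
      simpa [add_comm] using this
  have hanti : AntitoneOn F (Set.Ici 0) := by
    refine antitoneOn_of_deriv_nonpos (convex_Ici 0)
      (fun s hs => (hderiv s hs).continuousAt.continuousWithinAt) ?_ ?_
    · intro s hs
      rw [interior_Ici] at hs
      exact (hderiv s (le_of_lt hs)).differentiableAt.differentiableWithinAt
    · intro s hs
      rw [interior_Ici] at hs
      rw [(hderiv s (le_of_lt hs)).deriv]
      exact sub_nonpos.2 (h s hs)
  have hlim : Tendsto F atTop (𝓝 0) := by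
    have h1 : Tendsto (fun s : ℝ => ∑ i, w' i * (Real.log (s + μ' i) - Real.log s) -
        ∑ i, w i * (Real.log (s + μ i) - Real.log s)) atTop
        (𝓝 (∑ i, w' i * 0 - ∑ i, w i * 0)) :=
      (tendsto_finsetSum _ fun i _ =>
        (Real.tendsto_log_comp_add_sub_log (μ' i)).const_mul _).sub
      (tendsto_finsetSum _ fun i _ => (Real.tendsto_log_comp_add_sub_log (μ i)).const_mul _)
    simp only [mul_zero, Finset.sum_const_zero, sub_zero] at h1
    refine h1.congr fun s => ?_
    simp only [mul_sub, Finset.sum_sub_distrib, ← Finset.sum_mul, hw, hw', hF]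
    ring
  have h0 : 0 ≤ F 0 := by
    refine le_of_tendsto hlim ?_
    filter_upwards [eventually_ge_atTop 0] with s hs
    exact hanti (Set.mem_Ici.2 le_rfl) hs hs
  simpa [hF] using h0

lemma realDiagonal_inv {d : n → ℝ} (hd : ∀ i, 0 < d i) :
    (realDiagonal d)⁻¹ = realDiagonal fun i => (d i)⁻¹ := by
  refine inv_eq_right_inv ?_
  rw [realDiagonal_mul]
  simp [(hd _).ne', realDiagonal_const]

lemma realDiagonal_conj_apply_self (c : n → ℝ) (M : Matrix n n ℂ) (i : n) :
    (realDiagonal c * M * realDiagonal c) i i = c i * M i i * c i := by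
  rw [realDiagonal, mul_diagonal, diagonal_mul]

lemma Matrix.PosDef.inv_sub_inv_add_posSemidef {P E : Matrix n n ℂ} (hP : P.PosDef)
    (hE : E.PosSemidef) : (P⁻¹ - (P + E)⁻¹).PosSemidef := by
  have hR : (P + E).PosDef := hP.add_posSemidef hE
  have hPd := (isUnit_iff_isUnit_det P).1 hP.isUnit
  have hRd := (isUnit_iff_isUnit_det (P + E)).1 hR.isUnit
  have hS : (E + E * P⁻¹ * E).PosSemidef := by
    have := hP.inv.posSemidef.conjTranspose_mul_mul_same E
    rw [hE.1.eq] at this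
    exact hE.add this
  have key : P⁻¹ - (P + E)⁻¹ = (P + E)⁻¹ * (E + E * P⁻¹ * E) * (P + E)⁻¹ := by
    have h1 : (P + E) * (P⁻¹ - (P + E)⁻¹) * (P + E) = E + E * P⁻¹ * E := by
      rw [mul_sub, mul_nonsing_inv _ hRd, sub_mul, one_mul, add_mul P E, mul_nonsing_inv _ hPd,
        add_mul, one_mul, mul_add, mul_assoc E, nonsing_inv_mul _ hPd, mul_one]
      abel
    rw [← h1, mul_assoc (P + E), ← mul_assoc, nonsing_inv_mul _ hRd, one_mul, mul_assoc,
      mul_nonsing_inv _ hRd, mul_one]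
  rw [key]
  have := hS.conjTranspose_mul_mul_same (P + E)⁻¹
  rwa [hR.inv.1.eq] at this

lemma resolvent_conj_apply_self_re_le {M : Matrix n n ℂ} (hM : M.PosDef) {c : n → ℝ}
    (hc : ∀ j, 0 < c j) (hc1 : ∀ j, c j ≤ 1) {i : n} (hi : c i = 1) {s : ℝ} (hs : 0 < s) :
    ((realDiagonal c * M * realDiagonal c + s • 1)⁻¹ i i).re ≤ ((M + s • 1)⁻¹ i i).re := by
  have hP : (M + s • (1 : Matrix n n ℂ)).PosDef := by
    rw [← realDiagonal_const]
    exact hM.add (realDiagonal_posDef fun _ => hs)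
  have hE : (realDiagonal fun j => s * ((c j)⁻¹ * (c j)⁻¹ - 1)).PosSemidef := by
    refine PosSemidef.diagonal fun j => ?_
    have h1 : 1 ≤ (c j)⁻¹ := (one_le_inv₀ (hc j)).2 (hc1 j)
    have h2 : 0 ≤ s * ((c j)⁻¹ * (c j)⁻¹ - 1) :=
      mul_nonneg hs.le (by nlinarith)
    exact Complex.zero_le_real.2 h2
  have hR : realDiagonal c * M * realDiagonal c + s • 1 = realDiagonal c *
      (M + s • 1 + realDiagonal fun j => s * ((c j)⁻¹ * (c j)⁻¹ - 1)) * realDiagonal c := by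
    rw [add_assoc, ← realDiagonal_const, realDiagonal_add, mul_add, add_mul, realDiagonal_mul,
      realDiagonal_mul]
    congr 2
    ext j
    have := (hc j).ne'
    field_simp
    ring
  have h := (hP.inv_sub_inv_add_posSemidef hE).diag_nonneg (i := i)
  have h' := (Complex.le_def.1 h).1
  rw [hR, Matrix.mul_inv_rev, Matrix.mul_inv_rev, realDiagonal_inv hc, ← mul_assoc,
    realDiagonal_conj_apply_self, hi]
  simpa using h'

lemma mlog_apply_self_re_le_conj_of_le_one {M : Matrix n n ℂ} (hM : M.PosDef) {c : n → ℝ}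
    (hc : ∀ j, 0 < c j) (hc1 : ∀ j, c j ≤ 1) {i : n} (hi : c i = 1) :
    (mlog M i i).re ≤ (mlog (realDiagonal c * M * realDiagonal c) i i).re := by
  have hres := fun s hs => resolvent_conj_apply_self_re_le hM hc hc1 hi (s := s) hs
  obtain ⟨V, e, he, hV⟩ := (posDef_realDiagonal_conj hc hM).exists_eq_conj_realDiagonal
  rw [hV] at hres ⊢
  obtain ⟨U, d, hd, rfl⟩ := hM.exists_eq_conj_realDiagonal
  rw [mlog, mlog, cfc_conj_realDiagonal, cfc_conj_realDiagonal, conj_realDiagonal_apply_self_re,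
    conj_realDiagonal_apply_self_re]
  refine sum_mul_log_le_of_sum_div_le (sum_normSq_unitary U i) (sum_normSq_unitary V i) hd he
    fun s hs => ?_
  have := hres s hs
  rwa [conj_realDiagonal_add_smul_one, conj_realDiagonal_add_smul_one,
    conj_realDiagonal_inv _ fun j => add_pos (hd j) hs,
    conj_realDiagonal_inv _ fun j => add_pos (he j) hs, conj_realDiagonal_apply_self_re,
    conj_realDiagonal_apply_self_re] at this

lemma mlog_smul {M : Matrix n n ℂ} (hM : M.PosDef) {a : ℝ} (ha : 0 < a) :
    mlog (a • M) = mlog M + Real.log a • 1 := by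
  obtain ⟨U, d, hd, rfl⟩ := hM.exists_eq_conj_realDiagonal
  have h : a • ((U : Matrix n n ℂ) * realDiagonal d * star (U : Matrix n n ℂ)) =
      (U : Matrix n n ℂ) * realDiagonal (fun i => a * d i) * star (U : Matrix n n ℂ) := by
    have := realDiagonal_mul (fun _ => a) d
    rw [realDiagonal_const, smul_mul_assoc, one_mul] at this
    rw [← this, mul_smul_comm, smul_mul_assoc]
  rw [h, mlog, mlog, cfc_conj_realDiagonal, cfc_conj_realDiagonal, conj_realDiagonal_add_smul_one]
  congr 3
  ext i
  rw [Real.log_mul ha.ne' (hd i).ne', add_comm]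

/-- The positive diagonal matrix with entries `exp (g i / 2)`. -/
noncomputable def expHalf (g : n → ℝ) : Matrix n n ℂ :=
  realDiagonal fun i => Real.exp (g i / 2)

lemma expHalf_conj_posDef (g : n → ℝ) {M : Matrix n n ℂ} (hM : M.PosDef) :
    (expHalf g * M * expHalf g).PosDef :=
  posDef_realDiagonal_conj (fun _ => Real.exp_pos _) hM

lemma expHalf_add (g h : n → ℝ) : expHalf (fun i => g i + h i) = expHalf g * expHalf h := by
  rw [expHalf, expHalf, expHalf, realDiagonal_mul]
  simp only [add_div, Real.exp_add]

lemma expHalf_neg_conj (g : n → ℝ) (M : Matrix n n ℂ) :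
    expHalf (fun i => -g i) * (expHalf g * M * expHalf g) * expHalf (fun i => -g i) = M := by
  have h1 : expHalf (fun i => -g i) * expHalf g = 1 := by
    rw [← expHalf_add]
    simp [expHalf, realDiagonal_const]
  have h2 : expHalf g * expHalf (fun i => -g i) = 1 := by
    rw [← expHalf_add]
    simp [expHalf, realDiagonal_const]
  calc _ = (expHalf (fun i => -g i) * expHalf g) * M * (expHalf g * expHalf (fun i => -g i)) := by
        simp only [mul_assoc]
    _ = M := by rw [h1, h2, one_mul, mul_one]

lemma mlog_apply_self_re_add_le {M : Matrix n n ℂ} (hM : M.PosDef) {g : n → ℝ} {i : n}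
    (hg : ∀ j, g j ≤ g i) :
    (mlog M i i).re + g i ≤ (mlog (expHalf g * M * expHalf g) i i).re := by
  have h := mlog_apply_self_re_le_conj_of_le_one hM (c := fun j => Real.exp ((g j - g i) / 2))
    (fun _ => Real.exp_pos _)
    (fun j => Real.exp_le_one_iff.2 (by linarith [hg j])) (i := i) (by simp)
  have hE : expHalf g = Real.exp (g i / 2) • realDiagonal fun j => Real.exp ((g j - g i) / 2) := by
    have := realDiagonal_mul (fun _ => Real.exp (g i / 2)) fun j => Real.exp ((g j - g i) / 2)
    rw [realDiagonal_const, smul_mul_assoc, one_mul] at this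
    rw [this, expHalf]
    congr 1
    ext j
    rw [← Real.exp_add]
    congr 1
    ring
  rw [hE, smul_mul_assoc, smul_mul_assoc, mul_smul_comm, smul_smul, ← Real.exp_add, add_halves,
    mlog_smul (posDef_realDiagonal_conj (fun _ => Real.exp_pos _) hM) (Real.exp_pos _),
    Real.log_exp]
  simpa using h

lemma mlog_apply_self_re_le_add {M : Matrix n n ℂ} (hM : M.PosDef) {g : n → ℝ} {i : n}
    (hg : ∀ j, g i ≤ g j) :
    (mlog (expHalf g * M * expHalf g) i i).re ≤ (mlog M i i).re + g i := by
  have h := mlog_apply_self_re_add_le (expHalf_conj_posDef g hM) (g := fun j => -g j) (i := i)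
    fun j => neg_le_neg (hg j)
  rw [expHalf_neg_conj] at h
  linarith

lemma sum_mlog_expHalf_conj {M : Matrix n n ℂ} (hM : M.PosDef) (g : n → ℝ) :
    ∑ i, (mlog (expHalf g * M * expHalf g) i i).re = ∑ i, ((mlog M i i).re + g i) := by
  rw [sum_mlog_apply_self_re (expHalf_conj_posDef g hM), Finset.sum_add_distrib,
    sum_mlog_apply_self_re hM, det_mul, det_mul]
  have h1 : (expHalf g).det = ((∏ i, Real.exp (g i / 2) : ℝ) : ℂ) := by
    simp [expHalf, realDiagonal]
  have h2 : (∏ i, Real.exp (g i / 2)) ≠ 0 := (Finset.prod_pos fun _ _ => Real.exp_pos _).ne'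
  have h3 : M.det.re ≠ 0 := (Complex.lt_def.1 hM.det_pos).1.ne'
  rw [h1, mul_comm (_ * _), ← mul_assoc, ← Complex.ofReal_mul, Complex.re_ofReal_mul,
    Real.log_mul (mul_ne_zero h2 h2) h3, Real.log_mul h2 h2,
    Real.log_prod (fun i _ => (Real.exp_pos _).ne')]
  simp only [Real.log_exp]
  rw [← Finset.sum_add_distrib]
  simp only [add_halves]
  ring

/-- The trace inequality `∑ xᵢ (log M)ᵢᵢ + ∑ xᵢ gᵢ ≤ ∑ xᵢ (log (e^{g/2} M e^{g/2}))ᵢᵢ` for every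
positive definite `M`. -/
def TraceLogSuperadditive (x g : n → ℝ) : Prop :=
  ∀ M : Matrix n n ℂ, M.PosDef →
    ∑ i, x i * ((mlog M i i).re + g i) ≤
      ∑ i, x i * (mlog (expHalf g * M * expHalf g) i i).re

lemma TraceLogSuperadditive.add {x g h : n → ℝ} (hg : TraceLogSuperadditive x g)
    (hh : TraceLogSuperadditive x h) : TraceLogSuperadditive x fun i => g i + h i := by
  intro M hM
  have h1 := hg M hM
  have h2 := hh _ (expHalf_conj_posDef g hM)
  have h3 : expHalf (fun i => g i + h i) * M * expHalf (fun i => g i + h i) =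
      expHalf h * (expHalf g * M * expHalf g) * expHalf h := by
    rw [expHalf_add]
    nth_rewrite 1 [← expHalf_add]
    simp only [add_comm (g _)]
    rw [expHalf_add]
    simp only [mul_assoc]
  rw [h3]
  refine le_trans ?_ h2
  simp only [mul_add, Finset.sum_add_distrib] at h1 ⊢
  linarith

/-- The inequality holds when each index maximises or minimises `g`, with `x` at least `ξ` at the
maximisers and at most `ξ` at the minimisers. -/
lemma TraceLogSuperadditive.of_threshold {x g : n → ℝ} (ξ : ℝ)
    (h : ∀ i, (ξ ≤ x i ∧ ∀ j, g j ≤ g i) ∨ (x i ≤ ξ ∧ ∀ j, g i ≤ g j)) :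
    TraceLogSuperadditive x g := by
  intro M hM
  have hsum := sum_mlog_expHalf_conj hM g
  have key : ∑ i, (x i - ξ) * ((mlog M i i).re + g i) ≤
      ∑ i, (x i - ξ) * (mlog (expHalf g * M * expHalf g) i i).re := by
    refine Finset.sum_le_sum fun i _ => ?_
    rcases h i with ⟨hx, hi⟩ | ⟨hx, hi⟩
    · exact mul_le_mul_of_nonneg_left (mlog_apply_self_re_add_le hM hi) (sub_nonneg.2 hx)
    · exact mul_le_mul_of_nonpos_left (mlog_apply_self_re_le_add hM hi) (sub_nonpos.2 hx)
  simp only [sub_mul, Finset.sum_sub_distrib, ← Finset.mul_sum, hsum] at key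
  linarith

lemma Monovary.traceLogSuperadditive {x g : n → ℝ} (hgx : Monovary x g) :
    TraceLogSuperadditive x g := by
  induction hk : (Finset.univ.image g).card using Nat.strong_induction_on generalizing g with
  | _ k ih =>
  by_cases hconst : ∀ i j, g i ≤ g j
  · refine TraceLogSuperadditive.of_threshold 0 fun i => ?_
    rcases le_total 0 (x i) with h | h
    · exact Or.inl ⟨h, fun j => hconst j i⟩
    · exact Or.inr ⟨h, fun j => hconst i j⟩
  push Not at hconst
  obtain ⟨i₀, j₀, hij⟩ := hconst
  have : Nonempty n := ⟨i₀⟩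
  obtain ⟨p, hp⟩ := Finite.exists_max g
  have hne : (Finset.univ.filter fun i => g i < g p).Nonempty :=
    ⟨j₀, by simpa using hij.trans_le (hp i₀)⟩
  obtain ⟨q, hq, hqmax⟩ := Finset.exists_max_image _ g hne
  have hqp : g q < g p := by simpa using hq
  have hqmax' : ∀ i, g i < g p → g i ≤ g q := fun i hi => hqmax i (by simpa using hi)
  obtain ⟨m, hm, hmmin⟩ := Finset.exists_min_image (Finset.univ.filter fun i => g i = g p) x
    ⟨p, by simp⟩
  have hmp : g m = g p := by simpa using hm
  have hmmin' : ∀ i, g i = g p → x m ≤ x i := fun i hi => hmmin i (by simpa using hi)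
  have hdec : g = fun i => min (g i) (g q) + if g i = g p then g p - g q else 0 := by
    ext i
    by_cases hi : g i = g p
    · simp [hi, hqp.le]
    · simp [hi, hqmax' i (lt_of_le_of_ne (hp i) hi)]
  have hstep : TraceLogSuperadditive x fun i => if g i = g p then g p - g q else 0 := by
    refine TraceLogSuperadditive.of_threshold (x m) fun i => ?_
    have hpos : 0 ≤ g p - g q := by linarith
    by_cases hi : g i = g p
    · refine Or.inl ⟨hmmin' i hi, fun j => ?_⟩
      simp only [hi, if_true]
      split_ifs <;> linarith
    · refine Or.inr ⟨hgx (hmp ▸ lt_of_le_of_ne (hp i) hi), fun j => ?_⟩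
      simp only [hi, if_false]
      split_ifs <;> linarith
  have hmin : TraceLogSuperadditive x fun i => min (g i) (g q) := by
    refine ih _ ?_ (fun i j hij => hgx ?_) rfl
    · rw [← hk]
      refine Finset.card_lt_card ((Finset.ssubset_iff_of_subset ?_).2 ⟨g p, ?_, ?_⟩)
      · intro y hy
        obtain ⟨i, -, rfl⟩ := Finset.mem_image.1 hy
        rcases min_choice (g i) (g q) with h | h <;> rw [h] <;> simp
      · simp
      · simp only [Finset.mem_image, Finset.mem_univ, true_and, not_exists]
        intro i h
        exact absurd h ((min_le_right _ _).trans_lt hqp).ne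
    · by_contra! hcon
      exact hij.not_ge (min_le_min_right _ hcon)
  rw [hdec]
  exact hmin.add hstep

/-- A form of the Hiai–Petz inequality `tr X log (X^{r/2} M X^{r/2}) ≥ tr X (log X^r + log M)`. -/
lemma rtr_mul_mlog_conj_ge {X M : Matrix n n ℂ} (hX : X.PosDef) (hM : M.PosDef) {r : ℝ}
    (hr : 0 < r) :
    rtr (X * mlog M) + rtr (X * mlog (mpow X r)) ≤
      rtr (X * mlog (mpow (mpow X r) (1 / 2) * M * mpow (mpow X r) (1 / 2))) := by
  obtain ⟨U, x, hx, hXU⟩ := hX.exists_eq_conj_realDiagonal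
  have hU : star (U : Matrix n n ℂ) * U = 1 := Unitary.coe_star_mul_self U
  have hU' : (U : Matrix n n ℂ) * star (U : Matrix n n ℂ) = 1 := Unitary.coe_mul_star_self U
  set g : n → ℝ := fun i => r * Real.log (x i) with hg
  set N := star (U : Matrix n n ℂ) * M * U with hN
  have hNpd : N.PosDef := by
    have := (Matrix.IsUnit.posDef_star_left_conjugate_iff (x := M)
      (U := (U : Matrix n n ℂ)) (isUnit_unitaryGroup U)).2 hM
    exact this
  have htr : ∀ {K : Matrix n n ℂ}, K.PosDef →
      rtr (X * mlog ((U : Matrix n n ℂ) * K * star (U : Matrix n n ℂ))) =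
        ∑ i, x i * (mlog K i i).re := by
    intro K hK
    obtain ⟨V, d, hd, rfl⟩ := hK.exists_eq_conj_realDiagonal
    have h1 : (U : Matrix n n ℂ) * ((V : Matrix n n ℂ) * realDiagonal d *
        star (V : Matrix n n ℂ)) * star (U : Matrix n n ℂ) =
        ((U * V : unitaryGroup n ℂ) : Matrix n n ℂ) * realDiagonal d *
        star ((U * V : unitaryGroup n ℂ) : Matrix n n ℂ) := by
      simp [mul_assoc]
    rw [h1, mlog, mlog, cfc_conj_realDiagonal, cfc_conj_realDiagonal, hXU]
    set L := (V : Matrix n n ℂ) * realDiagonal (fun i => Real.log (d i)) *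
      star (V : Matrix n n ℂ) with hL
    have h2 : (U : Matrix n n ℂ) * realDiagonal x * star (U : Matrix n n ℂ) *
        (((U * V : unitaryGroup n ℂ) : Matrix n n ℂ) * realDiagonal (fun i => Real.log (d i)) *
        star ((U * V : unitaryGroup n ℂ) : Matrix n n ℂ)) =
        (U : Matrix n n ℂ) * realDiagonal x * (star (U : Matrix n n ℂ) * U) *
        L * star (U : Matrix n n ℂ) := by
      simp only [hL, Submonoid.coe_mul, star_mul, mul_assoc]
    rw [h2, hU, mul_one, rtr, mul_assoc (U : Matrix n n ℂ), mul_assoc (U : Matrix n n ℂ),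
      trace_mul_comm, mul_assoc, hU, mul_one]
    simp [trace, realDiagonal]
  have hMU : M = (U : Matrix n n ℂ) * N * star (U : Matrix n n ℂ) := by
    calc M = ((U : Matrix n n ℂ) * star (U : Matrix n n ℂ)) * M *
          ((U : Matrix n n ℂ) * star (U : Matrix n n ℂ)) := by rw [hU', one_mul, mul_one]
      _ = _ := by simp only [hN, mul_assoc]
  have hXr : mpow X r = (U : Matrix n n ℂ) * realDiagonal (fun i => x i ^ r) *
      star (U : Matrix n n ℂ) := by rw [hXU, mpow, cfc_conj_realDiagonal]
  have hXr2 : mpow (mpow X r) (1 / 2) = (U : Matrix n n ℂ) * expHalf g *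
      star (U : Matrix n n ℂ) := by
    rw [hXr, mpow, cfc_conj_realDiagonal, expHalf]
    congr 3
    ext i
    rw [← Real.rpow_mul (hx i).le, Real.rpow_def_of_pos (hx i), hg]
    congr 1
    ring
  have hconj : mpow (mpow X r) (1 / 2) * M * mpow (mpow X r) (1 / 2) =
      (U : Matrix n n ℂ) * (expHalf g * N * expHalf g) * star (U : Matrix n n ℂ) := by
    rw [hXr2, hN]
    simp only [mul_assoc]
  have hlogXr : rtr (X * mlog (mpow X r)) = ∑ i, x i * g i := by
    rw [hXr, mlog, cfc_conj_realDiagonal, hXU]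
    have h2 : (U : Matrix n n ℂ) * realDiagonal x * star (U : Matrix n n ℂ) *
        ((U : Matrix n n ℂ) * realDiagonal (fun i => Real.log (x i ^ r)) *
        star (U : Matrix n n ℂ)) =
        (U : Matrix n n ℂ) * (realDiagonal x * (star (U : Matrix n n ℂ) * U) *
        realDiagonal (fun i => Real.log (x i ^ r))) * star (U : Matrix n n ℂ) := by
      simp only [mul_assoc]
    rw [h2, hU, mul_one, realDiagonal_mul, rtr, trace_mul_comm, ← mul_assoc, hU, one_mul]
    simp only [Real.log_rpow (hx _), hg, realDiagonal, trace_diagonal, ← Complex.ofReal_sum,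
      Complex.ofReal_re]
  have hmono : Monovary x g := by
    intro i j hij
    have h1 : Real.log (x i) < Real.log (x j) := lt_of_mul_lt_mul_left hij hr.le
    exact ((Real.log_lt_log_iff (hx i) (hx j)).1 h1).le
  have h := hmono.traceLogSuperadditive N hNpd
  rw [hconj, htr (expHalf_conj_posDef g hNpd), hlogXr]
  nth_rewrite 1 [hMU]
  rw [htr hNpd, ← Finset.sum_add_distrib]
  simpa only [mul_add] using h

lemma mpow_posDef {M : Matrix n n ℂ} (hM : M.PosDef) (p : ℝ) : (mpow M p).PosDef := by
  obtain ⟨U, d, hd, rfl⟩ := hM.exists_eq_conj_realDiagonal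
  rw [mpow, cfc_conj_realDiagonal]
  exact (Matrix.IsUnit.posDef_star_right_conjugate_iff (isUnit_unitaryGroup U)).2
    (realDiagonal_posDef fun i => Real.rpow_pos_of_pos (hd i) p)

lemma mpow_mul_mpow_neg {M : Matrix n n ℂ} (hM : M.PosDef) (p : ℝ) :
    mpow M p * mpow M (-p) = 1 := by
  obtain ⟨U, d, hd, rfl⟩ := hM.exists_eq_conj_realDiagonal
  have hU : star (U : Matrix n n ℂ) * U = 1 := Unitary.coe_star_mul_self U
  have hU' : (U : Matrix n n ℂ) * star (U : Matrix n n ℂ) = 1 := Unitary.coe_mul_star_self U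
  rw [mpow, mpow, cfc_conj_realDiagonal, cfc_conj_realDiagonal]
  calc _ = (U : Matrix n n ℂ) * (realDiagonal (fun i => d i ^ p) *
        (star (U : Matrix n n ℂ) * U) * realDiagonal (fun i => d i ^ (-p))) *
        star (U : Matrix n n ℂ) := by simp only [mul_assoc]
    _ = 1 := by
      rw [hU, mul_one, realDiagonal_mul]
      simp only [← Real.rpow_add (hd _), add_neg_cancel, Real.rpow_zero, realDiagonal_const,
        one_smul, mul_one, hU']

lemma mlog_mpow {M : Matrix n n ℂ} (hM : M.PosDef) (p : ℝ) : mlog (mpow M p) = p • mlog M := by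
  obtain ⟨U, d, hd, rfl⟩ := hM.exists_eq_conj_realDiagonal
  have := realDiagonal_mul (fun _ => p) fun i => Real.log (d i)
  rw [realDiagonal_const, smul_mul_assoc, one_mul] at this
  rw [mlog, mpow, mlog, cfc_conj_realDiagonal, cfc_conj_realDiagonal, cfc_conj_realDiagonal,
    ← smul_mul_assoc, ← mul_smul_comm, this]
  simp only [Real.log_rpow (hd _)]

lemma rtr_mul_smul (X M : Matrix n n ℂ) (a : ℝ) : rtr (X * a • M) = a * rtr (X * M) := by
  simp [rtr, trace_smul]

lemma rtr_mul_add (X M N : Matrix n n ℂ) : rtr (X * (M + N)) = rtr (X * M) + rtr (X * N) := by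
  simp [rtr, mul_add]

end TraceLog

theorem stmt6 {n : Type*} [Fintype n] [DecidableEq n]
    (X Y : Matrix n n ℂ) (hX : X.PosDef) (hY : Y.PosDef) (t r : ℝ) (ht : t ≤ 0) (hr : 0 < r) :
    rtr (X * mlog (gm (mpow X r) (mpow Y r) t)) ≥
      rtr (X * ((1 - t) • mlog (mpow X r) + t • mlog (mpow Y r))) := by
  set A := mpow X r with hA
  set B := mpow Y r
  have hApd : A.PosDef := mpow_posDef hX r
  set C := mpow A (-(1 / 2))
  have hC : C.PosDef := mpow_posDef hApd _
  have hAC : mpow A (1 / 2) * C = 1 := mpow_mul_mpow_neg hApd (1 / 2)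
  have hCA : C * mpow A (1 / 2) = 1 := mul_eq_one_comm.1 hAC
  have hK : (C * B * C).PosDef := by
    have := (Matrix.IsUnit.posDef_star_right_conjugate_iff hC.isUnit).2 (mpow_posDef hY r)
    rwa [star_eq_conjTranspose, hC.1.eq] at this
  have h1 := rtr_mul_mlog_conj_ge hX (mpow_posDef hK t) hr
  have h2 := rtr_mul_mlog_conj_ge hX hK hr
  have hB : mpow A (1 / 2) * (C * B * C) * mpow A (1 / 2) = B := by
    calc _ = (mpow A (1 / 2) * C) * B * (C * mpow A (1 / 2)) := by simp only [mul_assoc]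
      _ = B := by rw [hAC, hCA, one_mul, mul_one]
  rw [← hA, hB] at h2
  rw [← hA, mlog_mpow hK, rtr_mul_smul] at h1
  rw [ge_iff_le, rtr_mul_add, rtr_mul_smul, rtr_mul_smul, gm]
  refine le_trans ?_ h1
  nlinarith [mul_le_mul_of_nonpos_left h2 ht]
end

section
/- Suppose the inequality Tr[X log(Y Z^p Y)] ≤ Tr[X(p log X + 2 log Y)] holds for all positive definite X, Y, Z with Tr[Z] = Tr[X], for p = p₁ and for p = p₂ (with p₁, p₂ > 0). Then it also holds for p = p₁ + p₂. -/
open Matrix ComplexOrder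

section MatrixPowers

variable {n : Type*} [Fintype n] [DecidableEq n] {A : Matrix n n ℂ}

theorem continuousOn_spectrum_real (f : ℝ → ℝ) (A : Matrix n n ℂ) :
    ContinuousOn f (spectrum ℝ A) :=
  A.finite_real_spectrum.continuousOn f

theorem Matrix.PosDef.pos_of_mem_spectrum_real (hA : A.PosDef) {x : ℝ} (hx : x ∈ spectrum ℝ A) :
    0 < x := by
  rw [hA.isHermitian.spectrum_real_eq_range_eigenvalues] at hx
  obtain ⟨i, rfl⟩ := hx
  exact hA.eigenvalues_pos i

theorem mpow_add (hA : A.PosDef) (p q : ℝ) : mpow A (p + q) = mpow A p * mpow A q := by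
  rw [mpow, mpow, mpow, ← cfc_mul _ _ A (continuousOn_spectrum_real _ A)
    (continuousOn_spectrum_real _ A)]
  exact cfc_congr fun x hx => Real.rpow_add (hA.pos_of_mem_spectrum_real hx) p q

theorem mpow_one (hA : A.PosDef) : mpow A 1 = A := by
  simp only [mpow, Real.rpow_one]
  exact cfc_id' ℝ A hA.isHermitian.isSelfAdjoint

theorem mpow_zero (hA : A.PosDef) : mpow A 0 = 1 := by
  simp only [mpow, Real.rpow_zero]
  exact cfc_const_one ℝ A hA.isHermitian.isSelfAdjoint

theorem isHermitian_mpow (A : Matrix n n ℂ) (p : ℝ) : (mpow A p).IsHermitian :=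
  cfc_predicate (R := ℝ) (p := IsSelfAdjoint) _ A

theorem isUnit_mpow (hA : A.PosDef) (p : ℝ) : IsUnit (mpow A p) := by
  refine IsUnit.of_mul_eq_one (mpow A (-p)) ?_
  rw [← mpow_add hA, add_neg_cancel, mpow_zero hA]

theorem mpow_half_mul_self (hA : A.PosDef) (p : ℝ) :
    mpow A (p / 2) * mpow A (p / 2) = mpow A p := by
  rw [← mpow_add hA, add_halves]

theorem posDef_mpow (hA : A.PosDef) (p : ℝ) : (mpow A p).PosDef := by
  have h := PosDef.conjTranspose_mul_self (mpow A (p / 2))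
    (mulVec_injective_of_isUnit (isUnit_mpow hA _))
  rwa [(isHermitian_mpow A _).eq, mpow_half_mul_self hA] at h

theorem mlog_mpow_s7 (hA : A.PosDef) (p : ℝ) : mlog (mpow A p) = p • mlog A := by
  have hA' : IsSelfAdjoint A := hA.isHermitian.isSelfAdjoint
  rw [mlog, mlog, mpow, ← cfc_comp' Real.log (fun x : ℝ => x ^ p) A
    ((A.finite_real_spectrum.image _).continuousOn _) (continuousOn_spectrum_real _ A) hA',
    ← cfc_smul p Real.log A (continuousOn_spectrum_real _ A)]
  exact cfc_congr fun x hx => Real.log_rpow (hA.pos_of_mem_spectrum_real hx) p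

theorem mpow_unitary_conj (hA : A.IsHermitian) {U : Matrix n n ℂ}
    (hU : U ∈ unitary (Matrix n n ℂ)) (p : ℝ) : mpow (Uᴴ * A * U) p = Uᴴ * mpow A p * U := by
  have hcont : Continuous fun B : Matrix n n ℂ => Uᴴ * B * U := by fun_prop
  have h := StarAlgHomClass.map_cfc
    (Unitary.conjStarAlgAut ℝ (Matrix n n ℂ) (star (⟨U, hU⟩ : unitary (Matrix n n ℂ))))
    (fun x : ℝ => x ^ p) A (continuousOn_spectrum_real _ A)
    (hcont.congr fun B => by
      simp [star_eq_conjTranspose])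
    hA.isSelfAdjoint (hA.isSelfAdjoint.map _)
  simpa [mpow, star_eq_conjTranspose] using h.symm

end MatrixPowers

theorem stmt7 {n : Type*} [Fintype n] [DecidableEq n] (p₁ p₂ : ℝ) (hp₁ : 0 < p₁) (hp₂ : 0 < p₂)
    (h₁ : ∀ X Y Z : Matrix n n ℂ, X.PosDef → Y.PosDef → Z.PosDef → Z.trace = X.trace →
      rtr (X * mlog (Y * mpow Z p₁ * Y)) ≤ rtr (X * (p₁ • mlog X + (2 : ℝ) • mlog Y)))
    (h₂ : ∀ X Y Z : Matrix n n ℂ, X.PosDef → Y.PosDef → Z.PosDef → Z.trace = X.trace →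
      rtr (X * mlog (Y * mpow Z p₂ * Y)) ≤ rtr (X * (p₂ • mlog X + (2 : ℝ) • mlog Y))) :
    ∀ X Y Z : Matrix n n ℂ, X.PosDef → Y.PosDef → Z.PosDef → Z.trace = X.trace →
      rtr (X * mlog (Y * mpow Z (p₁ + p₂) * Y)) ≤
        rtr (X * ((p₁ + p₂) • mlog X + (2 : ℝ) • mlog Y)) := by
  intro X Y Z hX hY hZ hZX
  set C := mpow Z (p₂ / 2) with hC
  have hCH : Cᴴ = C := isHermitian_mpow Z _
  have hYH : Yᴴ = Y := hY.isHermitian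
  have hM : (Y * mpow Z p₂ * Y).PosDef := by
    have h := (posDef_mpow hZ p₂).conjTranspose_mul_mul_same (mulVec_injective_of_isUnit hY.isUnit)
    rwa [hYH] at h
  set M := Y * mpow Z p₂ * Y with hMdef
  set W := mpow M (1 / 2) with hW
  have hWW : W * W = M := by rw [hW, mpow_half_mul_self hM, mpow_one hM]
  have hWpos : W.PosDef := posDef_mpow hM _
  have hWH : Wᴴ = W := hWpos.isHermitian
  have hWdet : IsUnit W.det := (isUnit_iff_isUnit_det W).mp hWpos.isUnit
  have hCY : C * Y * W⁻¹ * W = C * Y := nonsing_inv_mul_cancel_right _ _ hWdet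
  have hWCY : W * (C * Y * W⁻¹)ᴴ = Y * C := by
    have h := congrArg conjTranspose hCY
    rwa [conjTranspose_mul, hWH, conjTranspose_mul C Y, hCH, hYH] at h
  have hU : C * Y * W⁻¹ ∈ unitary (Matrix n n ℂ) := by
    have h : (C * Y * W⁻¹)ᴴ * (C * Y * W⁻¹) = 1 := by
      have hW' : W * ((C * Y * W⁻¹)ᴴ * (C * Y * W⁻¹)) = W * 1 := by
        calc W * ((C * Y * W⁻¹)ᴴ * (C * Y * W⁻¹)) = Y * (C * C) * Y * W⁻¹ := by
              rw [← mul_assoc, hWCY]; simp only [mul_assoc]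
          _ = W * 1 := by
              rw [hC, mpow_half_mul_self hZ, ← hMdef, ← hWW, mul_nonsing_inv_cancel_right _ _ hWdet,
                mul_one]
      exact hWpos.isUnit.mul_left_cancel hW'
    exact Unitary.mem_iff.mpr ⟨h, mul_eq_one_comm.mp h⟩
  set U := C * Y * W⁻¹
  have hVpos : (Uᴴ * Z * U).PosDef :=
    hZ.conjTranspose_mul_mul_same
      (mulVec_injective_of_isUnit (IsUnit.of_mul_eq_one _ (Unitary.mul_star_self_of_mem hU)))
  have hVtr : (Uᴴ * Z * U).trace = X.trace := by
    rw [trace_mul_cycle, ← star_eq_conjTranspose, Unitary.mul_star_self_of_mem hU, one_mul, hZX]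
  have hkey : W * mpow (Uᴴ * Z * U) p₁ * W = Y * mpow Z (p₁ + p₂) * Y := by
    calc W * mpow (Uᴴ * Z * U) p₁ * W
        = (W * Uᴴ) * mpow Z p₁ * (U * W) := by
          rw [mpow_unitary_conj hZ.isHermitian hU]; simp only [mul_assoc]
      _ = Y * (C * mpow Z p₁ * C) * Y := by rw [hWCY, hCY]; simp only [mul_assoc]
      _ = Y * mpow Z (p₁ + p₂) * Y := by
          rw [hC, ← mpow_add hZ, ← mpow_add hZ]
          congr 3
          ring
  have hlog : (2 : ℝ) • mlog W = mlog M := by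
    rw [hW, mlog_mpow_s7 hM, smul_smul]
    norm_num
  have e₁ := h₁ X W _ hX hWpos hVpos hVtr
  have e₂ := h₂ X Y Z hX hY hZ hZX
  rw [hkey, hlog] at e₁
  simp only [rtr, mul_add, add_smul, trace_add, Complex.add_re] at e₁ e₂ ⊢
  linarith
end
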